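/- arXiv:1710.00892 — 2 statements merged into one kernel-verified Lean document; each statement's English description precedes it below -/
import Mathlib

section
/- Let α₀, β₀ > 0, n ≥ 1, and λ > 1. Then the Rényi divergences of order λ between all neighboring Beta posteriors, namely D_λ(Beta(α₀+k+1, β₀+n−k−1) ‖ Beta(α₀+k, β₀+n−k)) and D_λ(Beta(α₀+k, β₀+n−k) ‖ Beta(α₀+k+1, β₀+n−k−1)) for every integer k with 0 ≤ k ≤ n−1, are all finite if and only if λ < 1 + min(α₀, β₀). In particular, direct posterior sampling in the Beta–Bernoulli system with prior Beta(α₀, β₀) achieves (λ, ε)-Rényi differential privacy for some finite ε if and only if 1 < λ < 1 + min(α₀, β₀). -/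
/-!
STATEMENT 5: For `α₀, β₀ > 0`, `n ≥ 1` and `λ > 1`, the order-`λ` Rényi divergences
between all neighboring Beta posteriors
`D_λ(Beta(α₀+k+1, β₀+n−k−1) ‖ Beta(α₀+k, β₀+n−k))` and
`D_λ(Beta(α₀+k, β₀+n−k) ‖ Beta(α₀+k+1, β₀+n−k−1))`, `0 ≤ k ≤ n−1`,
are all finite if and only if `λ < 1 + min(α₀, β₀)`.
-/

open MeasureTheory ENNReal

/-- The Beta function `B(a, b) = Γ(a)Γ(b)/Γ(a+b)`. -/
noncomputable def betaFun (a b : ℝ) : ℝ :=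
  Real.Gamma a * Real.Gamma b / Real.Gamma (a + b)

/-- Density of the `Beta(a, b)` distribution on `(0, 1)`:
`x ↦ x^{a−1}(1−x)^{b−1}/B(a,b)`. -/
noncomputable def betaPdf (a b : ℝ) (x : ℝ) : ℝ≥0∞ :=
  ENNReal.ofReal (x ^ (a - 1) * (1 - x) ^ (b - 1) / betaFun a b)

/-- Rényi divergence of order `l > 1` between measures given by densities `p`, `q`
with respect to a common dominating measure `ν`, with value `+∞` if the integral
diverges. -/
noncomputable def renyiDiv {Ω : Type*} [MeasurableSpace Ω] (ν : Measure Ω)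
    (p q : Ω → ℝ≥0∞) (l : ℝ) : EReal :=
  (((l - 1)⁻¹ : ℝ) : EReal) * ENNReal.log (∫⁻ ω, p ω ^ l * q ω ^ (1 - l) ∂ν)

/-- Rényi divergence of order `l` between `Beta(a, b)` and `Beta(a', b')`. -/
noncomputable def renyiDivBeta (a b a' b' : ℝ) (l : ℝ) : EReal :=
  renyiDiv (volume.restrict (Set.Ioo (0 : ℝ) 1)) (betaPdf a b) (betaPdf a' b') l

theorem betaFun_pos {a b : ℝ} (ha : 0 < a) (hb : 0 < b) : 0 < betaFun a b :=
  ProbabilityTheory.beta_pos ha hb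

/-- Near `0`, the Beta kernel is integrable exactly when its first parameter is positive. -/
theorem intervalIntegrable_betaKernel_zero_half (A B : ℝ) :
    IntervalIntegrable (fun x : ℝ ↦ x ^ (A - 1) * (1 - x) ^ (B - 1)) volume 0 (1 / 2) ↔
      0 < A := by
  have hcont (c : ℝ) : ContinuousOn (fun x : ℝ ↦ (1 - x) ^ c) (Set.uIcc 0 (1 / 2)) := by
    refine ContinuousOn.rpow_const (by fun_prop) fun x hx ↦ Or.inl ?_
    rw [Set.uIcc_of_le (by norm_num)] at hx
    linarith [hx.2]
  have hpow : IntervalIntegrable (fun x : ℝ ↦ x ^ (A - 1)) volume 0 (1 / 2) ↔ 0 < A := by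
    rw [intervalIntegrable_iff_integrableOn_Ioo_of_le (by norm_num),
      intervalIntegral.integrableOn_Ioo_rpow_iff (by norm_num)]
    constructor <;> intro h <;> linarith
  rw [← hpow]
  refine ⟨fun h ↦ ?_, fun h ↦ h.mul_continuousOn (hcont _)⟩
  refine (h.mul_continuousOn (hcont (1 - B))).congr fun x hx ↦ ?_
  rw [Set.uIoc_of_le (by norm_num)] at hx
  have hx' : (0 : ℝ) < 1 - x := by linarith [hx.2]
  simp [mul_assoc, ← Real.rpow_add hx']

theorem integrableOn_betaKernel_iff (A B : ℝ) :
    IntegrableOn (fun x : ℝ ↦ x ^ (A - 1) * (1 - x) ^ (B - 1)) (Set.Ioo 0 1) ↔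
      0 < A ∧ 0 < B := by
  have hright : IntervalIntegrable (fun x : ℝ ↦ x ^ (A - 1) * (1 - x) ^ (B - 1))
      volume (1 / 2) 1 ↔ 0 < B := by
    rw [← intervalIntegrable_betaKernel_zero_half B A]
    constructor <;> intro h <;> convert (h.comp_sub_left 1).symm using 1 <;>
      first | (ext x; simp [mul_comm]) | norm_num
  rw [← intervalIntegrable_iff_integrableOn_Ioo_of_le zero_le_one, ← hright,
    ← intervalIntegrable_betaKernel_zero_half A B]
  refine ⟨fun h ↦ ⟨h.mono_set ?_, h.mono_set ?_⟩, fun h ↦ h.1.trans h.2⟩ <;>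
  · rw [Set.uIcc_of_le (by norm_num), Set.uIcc_of_le (by norm_num)]
    exact Set.Icc_subset_Icc (by norm_num) (by norm_num)

theorem betaPdf_rpow_mul_rpow {a b a' b' l x : ℝ} (ha : 0 < a) (hb : 0 < b) (ha' : 0 < a')
    (hb' : 0 < b') (hx : x ∈ Set.Ioo (0 : ℝ) 1) :
    betaPdf a b x ^ l * betaPdf a' b' x ^ (1 - l) =
      ENNReal.ofReal ((betaFun a b ^ l * betaFun a' b' ^ (1 - l))⁻¹) *
        ENNReal.ofReal (x ^ (l * a + (1 - l) * a' - 1) *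
          (1 - x) ^ (l * b + (1 - l) * b' - 1)) := by
  have hx0 : 0 < x := hx.1
  have hx1 : 0 < 1 - x := by linarith [hx.2]
  have hC := betaFun_pos ha hb
  have hC' := betaFun_pos ha' hb'
  rw [betaPdf, betaPdf, ENNReal.ofReal_rpow_of_pos (by positivity),
    ENNReal.ofReal_rpow_of_pos (by positivity), ← ENNReal.ofReal_mul (by positivity),
    ← ENNReal.ofReal_mul (by positivity)]
  congr 1
  rw [Real.div_rpow (by positivity) hC.le, Real.div_rpow (by positivity) hC'.le,
    Real.mul_rpow (by positivity) (by positivity), Real.mul_rpow (by positivity) (by positivity),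
    ← Real.rpow_mul hx0.le, ← Real.rpow_mul hx0.le, ← Real.rpow_mul hx1.le,
    ← Real.rpow_mul hx1.le,
    show l * a + (1 - l) * a' - 1 = (a - 1) * l + (a' - 1) * (1 - l) by ring,
    show l * b + (1 - l) * b' - 1 = (b - 1) * l + (b' - 1) * (1 - l) by ring,
    Real.rpow_add hx0, Real.rpow_add hx1]
  field_simp

theorem renyiDiv_ne_top_iff {Ω : Type*} [MeasurableSpace Ω] (ν : Measure Ω)
    (p q : Ω → ℝ≥0∞) {l : ℝ} (hl : 1 < l) :
    renyiDiv ν p q l ≠ ⊤ ↔ ∫⁻ ω, p ω ^ l * q ω ^ (1 - l) ∂ν ≠ ⊤ := by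
  have hc : 0 < (l - 1)⁻¹ := inv_pos.2 (by linarith)
  rw [renyiDiv, Ne, EReal.mul_eq_top]
  simp [hc, hc.not_gt, ENNReal.log_eq_top_iff]

theorem renyiDivBeta_ne_top_iff {a b a' b' l : ℝ} (ha : 0 < a) (hb : 0 < b) (ha' : 0 < a')
    (hb' : 0 < b') (hl : 1 < l) :
    renyiDivBeta a b a' b' l ≠ ⊤ ↔
      0 < l * a + (1 - l) * a' ∧ 0 < l * b + (1 - l) * b' := by
  have hC := betaFun_pos ha hb
  have hC' := betaFun_pos ha' hb'
  have hK : 0 < (betaFun a b ^ l * betaFun a' b' ^ (1 - l))⁻¹ := by positivity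
  rw [renyiDivBeta, renyiDiv_ne_top_iff _ _ _ hl,
    setLIntegral_congr_fun measurableSet_Ioo
      fun x hx ↦ betaPdf_rpow_mul_rpow ha hb ha' hb' hx,
    lintegral_const_mul' _ _ ENNReal.ofReal_ne_top, ← integrableOn_betaKernel_iff]
  have hmeas : Measurable fun x : ℝ ↦ x ^ (l * a + (1 - l) * a' - 1) *
      (1 - x) ^ (l * b + (1 - l) * b' - 1) := by fun_prop
  rw [IntegrableOn, Integrable, and_iff_right hmeas.aestronglyMeasurable,
    hasFiniteIntegral_iff_ofReal, lt_top_iff_ne_top, Ne, Ne, ENNReal.mul_eq_top]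
  · simp only [hK.not_ge, ENNReal.ofReal_eq_zero, ENNReal.ofReal_ne_top, ne_eq, not_false_eq_true,
      true_and, false_and, or_false]
  · filter_upwards [ae_restrict_mem measurableSet_Ioo] with x hx
    exact mul_nonneg (Real.rpow_nonneg hx.1.le _) (Real.rpow_nonneg (by linarith [hx.2]) _)

theorem beta_bernoulli_direct_sampling_finite_iff
    (α₀ β₀ : ℝ) (hα : 0 < α₀) (hβ : 0 < β₀) (n : ℕ) (hn : 1 ≤ n)
    (l : ℝ) (hl : 1 < l) :
    (∀ k : ℕ, k ≤ n - 1 →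
        renyiDivBeta (α₀ + k + 1) (β₀ + n - k - 1) (α₀ + k) (β₀ + n - k) l ≠ ⊤ ∧
        renyiDivBeta (α₀ + k) (β₀ + n - k) (α₀ + k + 1) (β₀ + n - k - 1) l ≠ ⊤) ↔
      l < 1 + min α₀ β₀ := by
  have key (k : ℕ) (hk : k ≤ n - 1) :
      (renyiDivBeta (α₀ + k + 1) (β₀ + n - k - 1) (α₀ + k) (β₀ + n - k) l ≠ ⊤ ∧
        renyiDivBeta (α₀ + k) (β₀ + n - k) (α₀ + k + 1) (β₀ + n - k - 1) l ≠ ⊤) ↔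
      l < 1 + (β₀ + n - k - 1) ∧ l < 1 + (α₀ + k) := by
    have hk' : (k : ℝ) + 1 ≤ n := by exact_mod_cast (by omega : k + 1 ≤ n)
    have hk0 : (0 : ℝ) ≤ k := k.cast_nonneg
    rw [renyiDivBeta_ne_top_iff (by linarith) (by linarith) (by linarith) (by linarith) hl,
      renyiDivBeta_ne_top_iff (by linarith) (by linarith) (by linarith) (by linarith) hl]
    constructor
    · rintro ⟨⟨-, h₁⟩, h₂, -⟩
      constructor <;> linarith
    · rintro ⟨h₁, h₂⟩
      refine ⟨⟨?_, ?_⟩, ?_, ?_⟩ <;> linarith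
  rw [← min_add_add_left, lt_min_iff]
  constructor
  · intro h
    have h₀ := (key 0 (Nat.zero_le _)).1 (h 0 (Nat.zero_le _))
    have h₁ := (key (n - 1) le_rfl).1 (h (n - 1) le_rfl)
    rw [Nat.cast_sub hn] at h₁
    push_cast at h₀ h₁
    constructor <;> linarith [h₀.2, h₁.1]
  · rintro ⟨h₁, h₂⟩ k hk
    have hk' : (k : ℝ) + 1 ≤ n := by exact_mod_cast (by omega : k + 1 ≤ n)
    have hk0 : (0 : ℝ) ≤ k := k.cast_nonneg
    exact (key k hk).2 ⟨by linarith, by linarith⟩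
end

section
/- Let π be a probability density on ℝ^d such that −log π is twice differentiable and m-strongly convex for some m > 0. Let ρ > 0, L ≥ 0, and let ℓ₁,…,ℓₙ and ℓ'₁,…,ℓ'ₙ : ℝ^d → ℝ be convex, L-Lipschitz functions with ℓᵢ = ℓ'ᵢ for all indices except one. Let P and P' be the probability measures on ℝ^d with Lebesgue densities proportional to exp(−ρ·Σᵢ ℓᵢ(w))·π(w) and exp(−ρ·Σᵢ ℓ'ᵢ(w))·π(w), respectively. Then for every λ ≥ 1, D_λ(P ‖ P') ≤ (2ρ²L²/m)·λ, where order λ = 1 is interpreted as the Kullback–Leibler divergence. -/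
/-!
STATEMENT 13: Let `π` be a probability density on `ℝ^d` with `−log π` twice
differentiable and `m`-strongly convex, `ρ > 0`, `L ≥ 0`, and let
`ℓ₁,…,ℓₙ`, `ℓ'₁,…,ℓ'ₙ` be convex `L`-Lipschitz functions differing at only one index.
If `P`, `P'` have densities proportional to `exp(−ρΣᵢℓᵢ)·π` and `exp(−ρΣᵢℓ'ᵢ)·π`, then
for every `λ ≥ 1`, `D_λ(P ‖ P') ≤ (2ρ²L²/m)·λ` (order 1 interpreted as KL divergence).
-/

open MeasureTheory ENNReal

variable {d n : ℕ}

/-- Unnormalized Gibbs posterior density `exp(−ρ·Σᵢ ℓᵢ(w))·π(w)`. -/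
noncomputable def gibbsUnnorm (π : EuclideanSpace ℝ (Fin d) → ℝ) (ρ : ℝ)
    (ℓ : Fin n → EuclideanSpace ℝ (Fin d) → ℝ) (w : EuclideanSpace ℝ (Fin d)) : ℝ :=
  Real.exp (-(ρ * ∑ i, ℓ i w)) * π w

/-- Normalized Gibbs posterior density (w.r.t. Lebesgue measure on `ℝ^d`). -/
noncomputable def gibbsDens (π : EuclideanSpace ℝ (Fin d) → ℝ) (ρ : ℝ)
    (ℓ : Fin n → EuclideanSpace ℝ (Fin d) → ℝ) (w : EuclideanSpace ℝ (Fin d)) : ℝ≥0∞ :=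
  ENNReal.ofReal (gibbsUnnorm π ρ ℓ w) / ∫⁻ w', ENNReal.ofReal (gibbsUnnorm π ρ ℓ w')

/-- Kullback–Leibler divergence `KL(P‖Q) = ∫ log(dP/dQ) dP` if `P ≪ Q` (and the
integrand is integrable), `+∞` otherwise. -/
noncomputable def klDiv' {Ω : Type*} [MeasurableSpace Ω] (P Q : Measure Ω) : EReal :=
  @ite _ (P ≪ Q ∧ Integrable (llr P Q) P) (Classical.propDecidable _)
    ((∫ ω, llr P Q ω ∂P : ℝ) : EReal) ⊤

theorem Real.volume_add_le_of_add_mem {A B C : Set ℝ} (hA : MeasurableSet A)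
    (hB : MeasurableSet B) (hA' : A.Nonempty) (hB' : B.Nonempty)
    (hC : ∀ a ∈ A, ∀ b ∈ B, a + b ∈ C) : volume A + volume B ≤ volume C := by
  have key : ∀ K₁ ⊆ A, ∀ K₂ ⊆ B, IsCompact K₁ → IsCompact K₂ → K₁.Nonempty → K₂.Nonempty →
      volume K₁ + volume K₂ ≤ volume C := by
    intro K₁ h₁ K₂ h₂ c₁ c₂ n₁ n₂
    obtain ⟨a, ha, hamax⟩ := c₁.exists_isGreatest n₁
    obtain ⟨b, hb, hbmin⟩ := c₂.exists_isLeast n₂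
    have e₁ : volume ((fun x => x + -b) ⁻¹' K₁) = volume K₁ := measure_preimage_add_right _ _ _
    have e₂ : volume ((fun x => x + -a) ⁻¹' K₂) = volume K₂ := measure_preimage_add_right _ _ _
    rw [← e₁, ← e₂, ← measure_union₀]
    · refine measure_mono ?_
      rintro x (hx | hx)
      · simpa using hC _ (h₁ hx) _ (h₂ hb)
      · simpa using hC _ (h₁ ha) _ (h₂ hx)
    · exact ((measurable_add_const _) c₂.measurableSet).nullMeasurableSet
    · refine measure_mono_null (t := {a + b}) ?_ (by simp)
      rintro x ⟨hx, hx'⟩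
      have h1 := hamax hx
      have h2 := hbmin hx'
      simp only [Set.mem_singleton_iff]
      linarith
  obtain ⟨a, ha⟩ := hA'
  obtain ⟨b, hb⟩ := hB'
  rw [hA.measure_eq_iSup_isCompact, hB.measure_eq_iSup_isCompact]
  simp only [iSup_and']
  refine ENNReal.biSup_add_biSup_le' ⟨∅, by simp⟩ ⟨∅, by simp⟩ ?_
  rintro K₁ ⟨h₁, c₁⟩ K₂ ⟨h₂, c₂⟩
  refine le_trans (add_le_add (measure_mono (Set.subset_insert a K₁))
    (measure_mono (Set.subset_insert b K₂))) ?_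
  exact key _ (Set.insert_subset ha h₁) _ (Set.insert_subset hb h₂) (c₁.insert a) (c₂.insert b)
    (Set.insert_nonempty _ _) (Set.insert_nonempty _ _)

theorem ENNReal.rpow_mul_rpow_le_add {t : ℝ} (ht : 0 < t) (ht1 : t < 1) (a b : ℝ≥0∞) :
    a ^ t * b ^ (1 - t) ≤ ENNReal.ofReal t * a + ENNReal.ofReal (1 - t) * b := by
  have h1 : 0 < 1 - t := by linarith
  by_cases ha : a = ⊤
  · simp [ha, ht]
  by_cases hb : b = ⊤
  · simp [hb, ht1]
  rw [← ENNReal.ofReal_toReal ha, ← ENNReal.ofReal_toReal hb,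
    ENNReal.ofReal_rpow_of_nonneg (by simp) ht.le, ENNReal.ofReal_rpow_of_nonneg (by simp) h1.le,
    ← ENNReal.ofReal_mul (by positivity), ← ENNReal.ofReal_mul ht.le, ← ENNReal.ofReal_mul h1.le,
    ← ENNReal.ofReal_add (by positivity) (by positivity)]
  exact ENNReal.ofReal_le_ofReal
    (Real.geom_mean_le_arith_mean2_weighted ht.le h1.le (by simp) (by simp) (by ring))

theorem lintegral_add_le_of_levelSets {t : ℝ} (ht : 0 < t) (ht1 : t < 1) {f g h : ℝ → ℝ}
    (hf : Measurable f) (hg : Measurable g) (hh : Measurable h)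
    (hf0 : ∀ x, 0 ≤ f x) (hg0 : ∀ x, 0 ≤ g x) (hh0 : ∀ x, 0 ≤ h x)
    (hf1 : ∀ x, f x ≤ 1) (hg1 : ∀ x, g x ≤ 1)
    (hfs : ∀ s < 1, ∃ x, s < f x) (hgs : ∀ s < 1, ∃ x, s < g x)
    (hfg : ∀ x y, f x ^ t * g y ^ (1 - t) ≤ h (t * x + (1 - t) * y)) :
    ENNReal.ofReal t * (∫⁻ x, ENNReal.ofReal (f x)) +
      ENNReal.ofReal (1 - t) * (∫⁻ x, ENNReal.ofReal (g x)) ≤ ∫⁻ x, ENNReal.ofReal (h x) := by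
  have h1 : 0 < 1 - t := by linarith
  rw [lintegral_eq_lintegral_meas_lt _ (ae_of_all _ hf0) hf.aemeasurable,
    lintegral_eq_lintegral_meas_lt _ (ae_of_all _ hg0) hg.aemeasurable,
    lintegral_eq_lintegral_meas_lt _ (ae_of_all _ hh0) hh.aemeasurable,
    ← lintegral_const_mul' _ _ ENNReal.ofReal_ne_top,
    ← lintegral_const_mul' _ _ ENNReal.ofReal_ne_top]
  refine (le_lintegral_add _ _).trans (setLIntegral_mono' measurableSet_Ioi fun s hs => ?_)
  have hs : 0 < s := hs
  rcases lt_or_ge s 1 with hs1 | hs1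
  · have scale : ∀ {c : ℝ}, 0 < c → ∀ S : Set ℝ,
        ENNReal.ofReal c * volume S = volume ((c⁻¹ * ·) ⁻¹' S) := by
      intro c hc S
      rw [Real.volume_preimage_mul_left (by positivity), inv_inv, abs_of_pos hc]
    rw [scale ht, scale h1]
    refine Real.volume_add_le_of_add_mem
      ((measurable_const_mul _) (measurableSet_lt measurable_const hf))
      ((measurable_const_mul _) (measurableSet_lt measurable_const hg)) ?_ ?_ ?_
    · obtain ⟨x, hx⟩ := hfs s hs1
      exact ⟨t * x, by simpa [ht.ne'] using hx⟩
    · obtain ⟨x, hx⟩ := hgs s hs1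
      exact ⟨(1 - t) * x, by simpa [h1.ne'] using hx⟩
    · intro a ha b hb
      have ha : s < f (t⁻¹ * a) := ha
      have hb : s < g ((1 - t)⁻¹ * b) := hb
      have := hfg (t⁻¹ * a) ((1 - t)⁻¹ * b)
      rw [mul_inv_cancel_left₀ ht.ne', mul_inv_cancel_left₀ h1.ne'] at this
      refine lt_of_lt_of_le ?_ this
      calc s = s ^ t * s ^ (1 - t) := by rw [← Real.rpow_add hs]; simp
        _ < _ := mul_lt_mul'' (Real.rpow_lt_rpow hs.le ha ht) (Real.rpow_lt_rpow hs.le hb h1)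
              (by positivity) (by positivity)
  · have e1 : {a | s < f a} = ∅ := by
      ext x; simpa using (hf1 x).trans hs1
    have e2 : {a | s < g a} = ∅ := by
      ext x; simpa using (hg1 x).trans hs1
    simp [e1, e2]

/-- The Prékopa–Leindler inequality with weights `t`, `1 - t` holds on `(E, μ)`. -/
def PrekopaLeindler (t : ℝ) {E : Type*} [AddCommGroup E] [Module ℝ E] [MeasurableSpace E]
    (μ : Measure E) : Prop :=
  ∀ f g h : E → ℝ≥0∞, Measurable f → Measurable g → Measurable h →
    (∀ x y, f x ^ t * g y ^ (1 - t) ≤ h (t • x + (1 - t) • y)) →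
    (∫⁻ x, f x ∂μ) ^ t * (∫⁻ x, g x ∂μ) ^ (1 - t) ≤ ∫⁻ x, h x ∂μ

namespace PrekopaLeindler

theorem of_iSup_eq_one {t : ℝ} (ht : 0 < t) (ht1 : t < 1) {f g h : ℝ → ℝ≥0∞}
    (hf : Measurable f) (hg : Measurable g) (hh : Measurable h)
    (hf1 : ⨆ x, f x = 1) (hg1 : ⨆ x, g x = 1)
    (hfg : ∀ x y, f x ^ t * g y ^ (1 - t) ≤ h (t * x + (1 - t) * y)) :
    (∫⁻ x, f x) ^ t * (∫⁻ x, g x) ^ (1 - t) ≤ ∫⁻ x, h x := by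
  have h1 : 0 < 1 - t := by linarith
  have sup_lt : ∀ {u : ℝ → ℝ≥0∞}, ⨆ x, u x = 1 → ∀ s < (1 : ℝ), ∃ x, s < (u x).toReal := by
    intro u hu s hs
    obtain ⟨x, hx⟩ := lt_iSup_iff.1 (hu ▸ (by simpa using hs) : ENNReal.ofReal s < ⨆ x, u x)
    have hx1 : u x ≠ ⊤ := ((le_iSup u x).trans hu.le).trans_lt one_lt_top |>.ne
    exact ⟨x, (ENNReal.ofReal_lt_ofReal_iff'.1 ((ENNReal.ofReal_toReal hx1).symm ▸ hx)).1⟩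
  have le1 : ∀ {u : ℝ → ℝ≥0∞}, ⨆ x, u x = 1 → ∀ x, u x ≤ 1 := fun hu x =>
    (le_iSup _ x).trans hu.le
  have toR : ∀ {u : ℝ → ℝ≥0∞}, ⨆ x, u x = 1 → ∀ x, ENNReal.ofReal (u x).toReal = u x :=
    fun hu x => ENNReal.ofReal_toReal ((le1 hu x).trans_lt one_lt_top).ne
  have key := lintegral_add_le_of_levelSets ht ht1 hf.ennreal_toReal hg.ennreal_toReal
    (measurable_const.min hh : Measurable fun x => min 1 (h x)).ennreal_toReal
    (by simp) (by simp) (by simp)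
    (fun x => ENNReal.toReal_mono one_ne_top (le1 hf1 x))
    (fun x => ENNReal.toReal_mono one_ne_top (le1 hg1 x)) (sup_lt hf1) (sup_lt hg1) (by
      intro x y
      rw [ENNReal.toReal_rpow, ENNReal.toReal_rpow, ← ENNReal.toReal_mul]
      refine ENNReal.toReal_mono (by simp) (le_min ?_ (hfg x y))
      exact mul_le_one' (ENNReal.rpow_le_one (le1 hf1 x) ht.le)
        (ENNReal.rpow_le_one (le1 hg1 y) h1.le))
  simp only [toR hf1, toR hg1] at key
  refine (ENNReal.rpow_mul_rpow_le_add ht ht1 _ _).trans (key.trans (lintegral_mono fun x => ?_))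
  exact ENNReal.ofReal_toReal_le.trans (min_le_right _ _)

theorem of_bounded {t : ℝ} (ht : 0 < t) (ht1 : t < 1) {f g h : ℝ → ℝ≥0∞}
    (hf : Measurable f) (hg : Measurable g) (hh : Measurable h) {N : ℝ≥0∞} (hN : N ≠ ⊤)
    (hfN : ∀ x, f x ≤ N) (hgN : ∀ x, g x ≤ N)
    (hfg : ∀ x y, f x ^ t * g y ^ (1 - t) ≤ h (t * x + (1 - t) * y)) :
    (∫⁻ x, f x) ^ t * (∫⁻ x, g x) ^ (1 - t) ≤ ∫⁻ x, h x := by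
  have h1 : 0 < 1 - t := by linarith
  set a := ⨆ x, f x with ha
  set b := ⨆ x, g x with hb
  have haN : a ≠ ⊤ := ((iSup_le hfN).trans_lt hN.lt_top).ne
  have hbN : b ≠ ⊤ := ((iSup_le hgN).trans_lt hN.lt_top).ne
  by_cases ha0 : a = 0
  · have : ∀ x, f x = 0 := by simpa [ha] using ha0
    simp [this, ht]
  by_cases hb0 : b = 0
  · have : ∀ x, g x = 0 := by simpa [hb] using hb0
    simp [this, ht1]
  have hat0 : a ^ t ≠ 0 := by simp [ENNReal.rpow_eq_zero_iff, ha0, haN]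
  have hbt0 : b ^ (1 - t) ≠ 0 := by simp [ENNReal.rpow_eq_zero_iff, hb0, hbN]
  have hat : a ^ t ≠ ⊤ := by simp [ENNReal.rpow_eq_top_iff, ha0, haN]
  have hbt : b ^ (1 - t) ≠ ⊤ := by simp [ENNReal.rpow_eq_top_iff, hb0, hbN]
  have key := of_iSup_eq_one ht ht1 (hf.const_mul a⁻¹) (hg.const_mul b⁻¹)
    (hh.const_mul ((a ^ t)⁻¹ * (b ^ (1 - t))⁻¹))
    (by rw [← ENNReal.mul_iSup]; exact ENNReal.inv_mul_cancel ha0 haN)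
    (by rw [← ENNReal.mul_iSup]; exact ENNReal.inv_mul_cancel hb0 hbN) (by
      intro x y
      rw [ENNReal.mul_rpow_of_nonneg _ _ ht.le, ENNReal.mul_rpow_of_nonneg _ _ h1.le,
        ENNReal.inv_rpow, ENNReal.inv_rpow, mul_mul_mul_comm]
      gcongr
      exact hfg x y)
  rw [lintegral_const_mul _ hf, lintegral_const_mul _ hg, lintegral_const_mul _ hh,
    ENNReal.mul_rpow_of_nonneg _ _ ht.le, ENNReal.mul_rpow_of_nonneg _ _ h1.le,
        ENNReal.inv_rpow, ENNReal.inv_rpow, mul_mul_mul_comm] at key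
  refine (ENNReal.mul_le_mul_iff_right ?_ ?_).1 key
  · simp [hat, hbt]
  · simp [ENNReal.mul_eq_top, hat0, hbt0]

theorem real {t : ℝ} (ht : 0 < t) (ht1 : t < 1) : PrekopaLeindler t (volume : Measure ℝ) := by
  intro f g h hf hg hh hfg
  have h1 : 0 < 1 - t := by linarith
  have approx : ∀ {u : ℝ → ℝ≥0∞}, Measurable u →
      Filter.Tendsto (fun N : ℕ => ∫⁻ x, min (u x) N) Filter.atTop (nhds (∫⁻ x, u x)) := by
    intro u hu
    refine lintegral_tendsto_of_tendsto_of_monotone (fun N => by fun_prop)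
      (ae_of_all _ fun x i j hij => by dsimp only; gcongr) (ae_of_all _ fun x => ?_)
    simpa using tendsto_const_nhds.min ENNReal.tendsto_nat_nhds_top
  by_cases hf0 : ∫⁻ x, f x = 0
  · simp [hf0, ht]
  by_cases hg0 : ∫⁻ x, g x = 0
  · simp [hg0, ht1]
  have lim := ENNReal.Tendsto.mul ((approx hf).ennrpow_const t)
    (Or.inl (by simp [ENNReal.rpow_eq_zero_iff, hf0, ht.le]))
    ((approx hg).ennrpow_const (1 - t))
    (Or.inl (by simp [ENNReal.rpow_eq_zero_iff, hg0, ht1.le]))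
  refine le_of_tendsto' lim fun N => ?_
  refine of_bounded ht ht1 (by fun_prop) (by fun_prop) hh (ENNReal.natCast_ne_top N)
    (fun x => min_le_right _ _) (fun x => min_le_right _ _) fun x y => le_trans ?_ (hfg x y)
  gcongr
  · exact min_le_left _ _
  · exact min_le_left _ _

theorem prod {t : ℝ} {E F : Type*} [AddCommGroup E] [Module ℝ E] [MeasurableSpace E]
    [AddCommGroup F] [Module ℝ F] [MeasurableSpace F] {μ : Measure E} {ν : Measure F} [SFinite ν]
    (hμ : PrekopaLeindler t μ) (hν : PrekopaLeindler t ν) : PrekopaLeindler t (μ.prod ν) := by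
  intro f g h hf hg hh hfg
  rw [lintegral_prod _ hf.aemeasurable, lintegral_prod _ hg.aemeasurable,
    lintegral_prod _ hh.aemeasurable]
  refine hμ _ _ _ hf.lintegral_prod_right' hg.lintegral_prod_right' hh.lintegral_prod_right'
    fun x y => ?_
  exact hν _ _ _ (hf.comp measurable_prodMk_left) (hg.comp measurable_prodMk_left)
    (hh.comp measurable_prodMk_left) fun x' y' => hfg (x, x') (y, y')

theorem of_measurePreserving {t : ℝ} {E F : Type*} [AddCommGroup E] [Module ℝ E]
    [MeasurableSpace E] [AddCommGroup F] [Module ℝ F] [MeasurableSpace F] {μ : Measure E}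
    {ν : Measure F} (hμ : PrekopaLeindler t μ) {e : E → F} (he : MeasurePreserving e μ ν)
    (hadd : ∀ x y, e (x + y) = e x + e y) (hsmul : ∀ (c : ℝ) x, e (c • x) = c • e x) :
    PrekopaLeindler t ν := by
  intro f g h hf hg hh hfg
  rw [← he.lintegral_comp hf, ← he.lintegral_comp hg, ← he.lintegral_comp hh]
  refine hμ _ _ _ (hf.comp he.measurable) (hg.comp he.measurable) (hh.comp he.measurable)
    fun x y => ?_
  simpa only [hadd, hsmul] using hfg (e x) (e y)

theorem pi {t : ℝ} (ht : 0 < t) (ht1 : t < 1) (d : ℕ) :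
    PrekopaLeindler t (volume : Measure (Fin d → ℝ)) := by
  induction d with
  | zero =>
    intro f g h hf hg hh hfg
    have hvol : volume (Set.univ : Set (Fin 0 → ℝ)) = 1 := by simp [volume_pi]
    simp only [lintegral_unique, hvol, mul_one]
    exact (hfg _ _).trans (congrArg h (Subsingleton.elim _ _)).le
  | succ d ih =>
    refine ((real ht ht1).prod ih).of_measurePreserving
      (volume_preserving_piFinSuccAbove (fun _ : Fin (d + 1) => ℝ) 0).symm ?_ ?_
    · intro x y
      ext i
      refine Fin.cases ?_ (fun i => ?_) i <;>
        simp [MeasurableEquiv.piFinSuccAbove_symm_apply, Fin.insertNthEquiv]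
    · intro c x
      ext i
      refine Fin.cases ?_ (fun i => ?_) i <;>
        simp [MeasurableEquiv.piFinSuccAbove_symm_apply, Fin.insertNthEquiv]

theorem euclideanSpace {t : ℝ} (ht : 0 < t) (ht1 : t < 1) (d : ℕ) :
    PrekopaLeindler t (volume : Measure (EuclideanSpace ℝ (Fin d))) :=
  (pi ht ht1 d).of_measurePreserving (PiLp.volume_preserving_toLp (Fin d)) (fun _ _ => rfl)
    (fun _ _ => rfl)

end PrekopaLeindler

theorem ENNReal.ofReal_exp_rpow (x t : ℝ) :
    ENNReal.ofReal (Real.exp x) ^ t = ENNReal.ofReal (Real.exp (t * x)) := by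
  rw [ENNReal.ofReal_rpow_of_pos (Real.exp_pos _), ← Real.exp_mul, mul_comm]

theorem ENNReal.ofReal_exp_mul_ofReal_exp (x y : ℝ) :
    ENNReal.ofReal (Real.exp x) * ENNReal.ofReal (Real.exp y) =
      ENNReal.ofReal (Real.exp (x + y)) := by
  rw [← ENNReal.ofReal_mul (Real.exp_pos _).le, ← Real.exp_add]

theorem lintegral_ofReal_exp_ne_zero {Ω : Type*} [MeasurableSpace Ω] {ν : Measure Ω} [NeZero ν]
    {u : Ω → ℝ} (hu : Measurable u) : ∫⁻ x, ENNReal.ofReal (Real.exp (u x)) ∂ν ≠ 0 := by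
  have hsupp : Function.support (fun x => ENNReal.ofReal (Real.exp (u x))) = Set.univ := by
    ext x
    simp [Real.exp_pos]
  rw [← pos_iff_ne_zero, lintegral_pos_iff_support (by fun_prop), hsupp]
  exact Measure.measure_univ_pos.2 (NeZero.ne _)

section StronglyLogConcave

variable {m G : ℝ} {V h : EuclideanSpace ℝ (Fin d) → ℝ}

theorem StrongConvexOn.prekopaLeindler (hV : StrongConvexOn Set.univ m V) (hVm : Measurable V)
    {t : ℝ} (ht : 0 < t) (ht1 : t < 1) {a b c : EuclideanSpace ℝ (Fin d) → ℝ}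
    (ha : Measurable a) (hb : Measurable b) (hc : Measurable c)
    (habc : ∀ x y, t * a x + (1 - t) * b y ≤
      c (t • x + (1 - t) • y) + t * (1 - t) * (m / 2 * ‖x - y‖ ^ 2)) :
    (∫⁻ x, ENNReal.ofReal (Real.exp (a x - V x))) ^ t *
      (∫⁻ x, ENNReal.ofReal (Real.exp (b x - V x))) ^ (1 - t) ≤
      ∫⁻ x, ENNReal.ofReal (Real.exp (c x - V x)) := by
  refine PrekopaLeindler.euclideanSpace ht ht1 d _ _ _ (by fun_prop) (by fun_prop) (by fun_prop)
    fun x y => ?_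
  rw [ENNReal.ofReal_exp_rpow, ENNReal.ofReal_exp_rpow, ENNReal.ofReal_exp_mul_ofReal_exp]
  refine ENNReal.ofReal_le_ofReal (Real.exp_le_exp.2 ?_)
  have := hV.2 (Set.mem_univ x) (Set.mem_univ y) ht.le (sub_pos.2 ht1).le (by ring)
  simp only [smul_eq_mul] at this
  linarith [habc x y]

/-- A Lipschitz function is exponentially integrable against a strongly log-concave density. -/
theorem StrongConvexOn.lintegral_exp_sub_ne_top (hm : 0 < m)
    (hV : StrongConvexOn Set.univ m V) (hVm : Measurable V)
    (hfin : ∫⁻ x, ENNReal.ofReal (Real.exp (-V x)) ≠ ⊤) (hh : Measurable h)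
    (hlip : ∀ u v, h u - h v ≤ G * ‖u - v‖) :
    ∫⁻ x, ENNReal.ofReal (Real.exp (h x - V x)) ≠ ⊤ := by
  have key := hV.prekopaLeindler hVm (t := 1 / 2) (by norm_num) (by norm_num) hh hh.neg
    (measurable_const (a := G ^ 2 / (2 * m))) (fun x y => by
      have hxy := hlip x y
      have : 0 ≤ (m * ‖x - y‖ / 2 - G) ^ 2 / (2 * m) := by positivity
      have e : (m * ‖x - y‖ / 2 - G) ^ 2 / (2 * m) =
          m * ‖x - y‖ ^ 2 / 8 - G * ‖x - y‖ / 2 + G ^ 2 / (2 * m) := by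
        field_simp
        ring
      simp only [Pi.neg_apply]
      nlinarith)
  have hR : ∫⁻ x, ENNReal.ofReal (Real.exp (G ^ 2 / (2 * m) - V x)) ≠ ⊤ := by
    simp only [sub_eq_add_neg, ← ENNReal.ofReal_exp_mul_ofReal_exp]
    rw [lintegral_const_mul' _ _ ENNReal.ofReal_ne_top]
    exact ENNReal.mul_ne_top ENNReal.ofReal_ne_top hfin
  intro htop
  rw [htop, ENNReal.top_rpow_of_pos (by norm_num), ENNReal.top_mul] at key
  · exact hR (top_le_iff.1 key)
  · have hpos : ∫⁻ x, ENNReal.ofReal (Real.exp ((-h) x - V x)) ≠ 0 :=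
      lintegral_ofReal_exp_ne_zero (by fun_prop)
    rw [Ne, ENNReal.rpow_eq_zero_iff]
    norm_num
    exact hpos

/-- Exponential moments of a Lipschitz log-likelihood ratio against a strongly log-concave
probability density. -/
theorem StrongConvexOn.lintegral_exp_mul_sub_le (hm : 0 < m)
    (hV : StrongConvexOn Set.univ m V) (hVm : Measurable V)
    (hV1 : ∫⁻ x, ENNReal.ofReal (Real.exp (-V x)) = 1) (hh : Measurable h)
    (hh1 : ∫⁻ x, ENNReal.ofReal (Real.exp (h x - V x)) = 1)
    (hlip : ∀ u v, h u - h v ≤ G * ‖u - v‖) {l : ℝ} (hl : 1 < l) :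
    ∫⁻ x, ENNReal.ofReal (Real.exp (l * h x - V x)) ≤
      ENNReal.ofReal (Real.exp ((l - 1) * (G ^ 2 / (2 * m) * l))) := by
  have hl0 : 0 < l := by linarith
  have hl1 : l⁻¹ < 1 := inv_lt_one_of_one_lt₀ hl
  set κ := G ^ 2 / (2 * m) * l with hκ
  have key := hV.prekopaLeindler hVm (inv_pos.2 hl0) hl1 (hh.const_mul l)
    (measurable_const (a := -κ)) hh (fun x y => by
      have hxy := hlip x (l⁻¹ • x + (1 - l⁻¹) • y)
      have hd : x - (l⁻¹ • x + (1 - l⁻¹) • y) = (1 - l⁻¹) • (x - y) := by module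
      rw [hd, norm_smul, Real.norm_of_nonneg (by linarith)] at hxy
      have hsq : 0 ≤ (1 - l⁻¹) * ((m * ‖x - y‖ - G * l) ^ 2 / (2 * m * l)) :=
        mul_nonneg (by linarith) (by positivity)
      have e : (m * ‖x - y‖ - G * l) ^ 2 / (2 * m * l) =
          l⁻¹ * (m / 2 * ‖x - y‖ ^ 2) - G * ‖x - y‖ + κ := by
        rw [hκ]
        field_simp
        ring
      rw [e] at hsq
      rw [inv_mul_cancel_left₀ hl0.ne']
      nlinarith)
  have hB : ∫⁻ x, ENNReal.ofReal (Real.exp (-κ - V x)) = ENNReal.ofReal (Real.exp (-κ)) := by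
    simp only [sub_eq_add_neg, ← ENNReal.ofReal_exp_mul_ofReal_exp]
    rw [lintegral_const_mul' _ _ ENNReal.ofReal_ne_top, hV1, mul_one]
  rw [hB, hh1, ENNReal.ofReal_exp_rpow] at key
  have key' := ENNReal.rpow_le_rpow key hl0.le
  rw [ENNReal.mul_rpow_of_nonneg _ _ hl0.le, ENNReal.rpow_inv_rpow hl0.ne', ENNReal.one_rpow,
    ENNReal.ofReal_exp_rpow] at key'
  have e : l * ((1 - l⁻¹) * -κ) = -((l - 1) * κ) := by
    field_simp
  rw [e] at key'
  set I := ∫⁻ x, ENNReal.ofReal (Real.exp (l * h x - V x))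
  calc I = I * ENNReal.ofReal (Real.exp (-((l - 1) * κ))) *
        ENNReal.ofReal (Real.exp ((l - 1) * κ)) := by
        rw [mul_assoc, ENNReal.ofReal_exp_mul_ofReal_exp]; simp
    _ ≤ 1 * ENNReal.ofReal (Real.exp ((l - 1) * κ)) := by gcongr
    _ = _ := one_mul _

end StronglyLogConcave

section Divergence

variable {Ω : Type*} [MeasurableSpace Ω] {ν : Measure Ω} {V h : Ω → ℝ} {B : ℝ}

theorem renyiDiv_exp_le {l : ℝ} (hl : 1 < l)
    (hB : ∫⁻ x, ENNReal.ofReal (Real.exp (l * h x - V x)) ∂ν ≤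
      ENNReal.ofReal (Real.exp ((l - 1) * B))) :
    renyiDiv ν (fun x => ENNReal.ofReal (Real.exp (h x - V x)))
      (fun x => ENNReal.ofReal (Real.exp (-V x))) l ≤ (B : EReal) := by
  have hl1 : 0 < l - 1 := by linarith
  have e : ∀ x, ENNReal.ofReal (Real.exp (h x - V x)) ^ l *
      ENNReal.ofReal (Real.exp (-V x)) ^ (1 - l) =
      ENNReal.ofReal (Real.exp (l * h x - V x)) := fun x => by
    rw [ENNReal.ofReal_exp_rpow, ENNReal.ofReal_exp_rpow, ENNReal.ofReal_exp_mul_ofReal_exp]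
    ring_nf
  simp only [renyiDiv, e]
  have hlog := ENNReal.log_monotone hB
  rw [ENNReal.log_ofReal_of_pos (Real.exp_pos _), Real.log_exp] at hlog
  refine (mul_le_mul_of_nonneg_left hlog (by exact_mod_cast (inv_pos.2 hl1).le)).trans_eq ?_
  rw [← EReal.coe_mul, inv_mul_cancel_left₀ hl1.ne']

theorem klDiv'_exp_le (hVm : Measurable V) (hhm : Measurable h)
    (hV1 : ∫⁻ x, ENNReal.ofReal (Real.exp (-V x)) ∂ν = 1)
    (hh1 : ∫⁻ x, ENNReal.ofReal (Real.exp (h x - V x)) ∂ν = 1)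
    (hB : ∀ l : ℝ, 1 < l → ∫⁻ x, ENNReal.ofReal (Real.exp (l * h x - V x)) ∂ν ≤
      ENNReal.ofReal (Real.exp ((l - 1) * (B * l)))) :
    klDiv' (ν.withDensity fun x => ENNReal.ofReal (Real.exp (h x - V x)))
      (ν.withDensity fun x => ENNReal.ofReal (Real.exp (-V x))) ≤ (B : EReal) := by
  set P := ν.withDensity fun x => ENNReal.ofReal (Real.exp (h x - V x)) with hP
  set Q := ν.withDensity fun x => ENNReal.ofReal (Real.exp (-V x)) with hQ
  have : IsProbabilityMeasure P := ⟨by simp [hP, hh1]⟩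
  have : IsProbabilityMeasure Q := ⟨by simp [hQ, hV1]⟩
  have hPQ : P = Q.withDensity fun x => ENNReal.ofReal (Real.exp (h x)) := by
    rw [hP, hQ, ← withDensity_mul _ (by fun_prop) (by fun_prop)]
    congr 1
    ext x
    rw [Pi.mul_apply, ENNReal.ofReal_exp_mul_ofReal_exp]
    ring_nf
  have hac : P ≪ Q := hPQ ▸ withDensity_absolutelyContinuous _ _
  have hllr : llr P Q =ᵐ[P] h := by
    refine hac.ae_le ?_
    have := Measure.rnDeriv_withDensity Q
      (show Measurable fun x => ENNReal.ofReal (Real.exp (h x)) by fun_prop)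
    rw [← hPQ] at this
    filter_upwards [this] with x hx
    simp [llr, hx, ENNReal.toReal_ofReal (Real.exp_pos _).le]
  have hPexp : ∀ s : ℝ, ∫⁻ x, ENNReal.ofReal (Real.exp (s * h x)) ∂P =
      ∫⁻ x, ENNReal.ofReal (Real.exp ((s + 1) * h x - V x)) ∂ν := fun s => by
    rw [hP, lintegral_withDensity_eq_lintegral_mul _ (by fun_prop) (by fun_prop)]
    refine lintegral_congr fun x => ?_
    rw [Pi.mul_apply, ENNReal.ofReal_exp_mul_ofReal_exp]
    ring_nf
  have hint : ∀ s : ℝ, ∫⁻ x, ENNReal.ofReal (Real.exp (s * h x)) ∂P ≠ ⊤ →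
      Integrable (fun x => Real.exp (s * h x)) P := fun s hs =>
    (lintegral_ofReal_ne_top_iff_integrable (by fun_prop)
      (ae_of_all _ fun x => (Real.exp_pos _).le)).1 hs
  have hle : ∀ s : ℝ, 0 < s → ∫⁻ x, ENNReal.ofReal (Real.exp (s * h x)) ∂P ≤
      ENNReal.ofReal (Real.exp (s * (B * (s + 1)))) := fun s hs => by
    simpa [hPexp] using hB (s + 1) (by linarith)
  have hinth : Integrable h P := by
    have h1 := hint 1 (ne_top_of_le_ne_top ENNReal.ofReal_ne_top (hle 1 one_pos))
    have h2 := hint (-1) (by rw [hPexp]; simp [hV1])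
    refine (h1.add h2).mono' hhm.aestronglyMeasurable (ae_of_all _ fun x => ?_)
    simp only [Pi.add_apply, Real.norm_eq_abs, one_mul, neg_one_mul]
    refine abs_le'.2 ⟨?_, ?_⟩
    · linarith [Real.add_one_le_exp (h x), Real.exp_pos (-h x)]
    · linarith [Real.add_one_le_exp (-h x), Real.exp_pos (h x)]
  have hbound : ∀ s : ℝ, 0 < s → ∫ x, h x ∂P ≤ B * (s + 1) := fun s hs => by
    set c := s * (B * (s + 1)) with hc
    have hi := hint s (ne_top_of_le_ne_top ENNReal.ofReal_ne_top (hle s hs))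
    have hE : ∫ x, Real.exp (s * h x) ∂P ≤ Real.exp c := by
      rw [integral_eq_lintegral_of_nonneg_ae (ae_of_all _ fun x => (Real.exp_pos _).le)
        hi.aestronglyMeasurable]
      exact ENNReal.toReal_le_of_le_ofReal (Real.exp_pos _).le (hle s hs)
    have hmono : ∫ x, s * h x ∂P ≤ ∫ x, (Real.exp (-c) * Real.exp (s * h x) + (c - 1)) ∂P := by
      refine integral_mono (hinth.const_mul s) ((hi.const_mul _).add (integrable_const _))
        fun x => ?_
      dsimp only
      rw [← Real.exp_add]
      linarith [Real.add_one_le_exp (-c + s * h x)]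
    rw [integral_add (hi.const_mul _) (integrable_const _), integral_const_mul,
      integral_const_mul, integral_const, probReal_univ, one_smul] at hmono
    have hmul := mul_le_mul_of_nonneg_left hE (Real.exp_pos (-c)).le
    rw [← Real.exp_add, neg_add_cancel, Real.exp_zero] at hmul
    exact le_of_mul_le_mul_left (by linarith) hs
  rw [klDiv', if_pos ⟨hac, hinth.congr hllr.symm⟩, integral_congr_ae hllr]
  refine EReal.coe_le_coe_iff.2 ?_
  have lim : Filter.Tendsto (fun s : ℝ => B * (s + 1)) (nhdsWithin 0 (Set.Ioi 0)) (nhds B) := by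
    have : Filter.Tendsto (fun s : ℝ => B * (s + 1)) (nhds 0) (nhds (B * (0 + 1))) :=
      (Continuous.tendsto (by fun_prop) 0)
    simpa using this.mono_left nhdsWithin_le_nhds
  exact ge_of_tendsto lim (eventually_mem_nhdsWithin.mono fun s hs => hbound s hs)

end Divergence

theorem gibbsDens_eq_exp {π : EuclideanSpace ℝ (Fin d) → ℝ} {ρ : ℝ} (hπpos : ∀ w, 0 < π w)
    {ℓ : Fin n → EuclideanSpace ℝ (Fin d) → ℝ} {U : EuclideanSpace ℝ (Fin d) → ℝ}
    (hU : ∀ w, U w = -Real.log (π w) + ρ * ∑ i, ℓ i w) (hUm : Measurable U)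
    (hfin : ∫⁻ w, ENNReal.ofReal (Real.exp (-U w)) ≠ ⊤) :
    ∃ c : ℝ, (gibbsDens π ρ ℓ = fun w => ENNReal.ofReal (Real.exp (-(U w + c)))) ∧
      ∫⁻ w, ENNReal.ofReal (Real.exp (-(U w + c))) = 1 := by
  have hu : ∀ w, gibbsUnnorm π ρ ℓ w = Real.exp (-U w) := fun w => by
    rw [gibbsUnnorm, hU, neg_add_rev, neg_neg, Real.exp_add, Real.exp_log (hπpos w)]
  set Z := ∫⁻ w, ENNReal.ofReal (Real.exp (-U w)) with hZ
  have hZ0 : Z ≠ 0 := lintegral_ofReal_exp_ne_zero hUm.neg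
  have hc : ENNReal.ofReal (Real.exp (-Real.log Z.toReal)) = Z⁻¹ := by
    rw [Real.exp_neg, Real.exp_log (ENNReal.toReal_pos hZ0 hfin),
      ENNReal.ofReal_inv_of_pos (ENNReal.toReal_pos hZ0 hfin), ENNReal.ofReal_toReal hfin]
  have hsplit : ∀ w, ENNReal.ofReal (Real.exp (-(U w + Real.log Z.toReal))) =
      ENNReal.ofReal (Real.exp (-U w)) * Z⁻¹ := fun w => by
    rw [← hc, ENNReal.ofReal_exp_mul_ofReal_exp, neg_add]
  refine ⟨Real.log Z.toReal, ?_, ?_⟩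
  · ext w
    simp only [gibbsDens, hu, ← hZ, hsplit, div_eq_mul_inv]
  · simp only [hsplit]
    rw [lintegral_mul_const _ (by fun_prop), ← hZ, ENNReal.mul_inv_cancel hZ0 hfin]

theorem ConvexOn.univ_finset_sum {E ι : Type*} [AddCommGroup E] [Module ℝ E] (s : Finset ι)
    {f : ι → E → ℝ} (hf : ∀ i, ConvexOn ℝ Set.univ (f i)) :
    ConvexOn ℝ Set.univ fun x => ∑ i ∈ s, f i x := by
  refine ⟨convex_univ, fun x _ y _ a b ha hb hab => ?_⟩
  simp only [smul_eq_mul, Finset.mul_sum, ← Finset.sum_add_distrib]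
  exact Finset.sum_le_sum fun i _ => (hf i).2 (Set.mem_univ x) (Set.mem_univ y) ha hb hab

theorem sum_sub_sum_le_of_lipschitz {ℓ : Fin n → EuclideanSpace ℝ (Fin d) → ℝ} {L : ℝ}
    (hlip : ∀ i u v, |ℓ i u - ℓ i v| ≤ L * ‖u - v‖) (u v : EuclideanSpace ℝ (Fin d)) :
    |∑ i, ℓ i u - ∑ i, ℓ i v| ≤ n * L * ‖u - v‖ := by
  rw [← Finset.sum_sub_distrib]
  refine (Finset.abs_sum_le_sum_abs _ _).trans
    ((Finset.sum_le_sum fun i _ => hlip i u v).trans_eq ?_)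
  simp [mul_assoc]

/-- The Gibbs posterior is a strongly log-concave probability density `exp (-U)`, where `U` is the
negative log-prior plus the scaled empirical risk, up to an additive constant. -/
theorem exists_gibbsDens_eq_exp {m ρ L : ℝ} (hm : 0 < m) (hρ : 0 < ρ)
    {π : EuclideanSpace ℝ (Fin d) → ℝ} (hπpos : ∀ w, 0 < π w) (hπprob : ∫ w, π w = 1)
    (hπm : Measurable fun w => -Real.log (π w))
    (hπsc : StrongConvexOn Set.univ m fun w => -Real.log (π w))
    {ℓ : Fin n → EuclideanSpace ℝ (Fin d) → ℝ} (hconv : ∀ i, ConvexOn ℝ Set.univ (ℓ i))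
    (hlip : ∀ i u v, |ℓ i u - ℓ i v| ≤ L * ‖u - v‖) :
    ∃ (c : ℝ) (U : EuclideanSpace ℝ (Fin d) → ℝ),
      (∀ w, U w = -Real.log (π w) + ρ * ∑ i, ℓ i w + c) ∧ Measurable U ∧
      StrongConvexOn Set.univ m U ∧
      gibbsDens π ρ ℓ = (fun w => ENNReal.ofReal (Real.exp (-U w))) ∧
      ∫⁻ w, ENNReal.ofReal (Real.exp (-U w)) = 1 := by
  have hℓm : Measurable fun w => ∑ i, ℓ i w := by
    refine (LipschitzWith.of_dist_le_mul (K := (n * L).toNNReal) fun u v => ?_).continuous.measurable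
    rw [Real.dist_eq, dist_eq_norm]
    refine (sum_sub_sum_le_of_lipschitz hlip u v).trans ?_
    gcongr
    exact Real.le_coe_toNNReal _
  have hfin : ∫⁻ w, ENNReal.ofReal (Real.exp (-(-Real.log (π w) + ρ * ∑ i, ℓ i w))) ≠ ⊤ := by
    have := hπsc.lintegral_exp_sub_ne_top (h := fun w => -(ρ * ∑ i, ℓ i w)) (G := ρ * (n * L))
      hm hπm ?_ (hℓm.const_mul ρ).neg fun u v => ?_
    · refine (lintegral_congr fun w => ?_).trans_ne this
      ring_nf
    · simp only [neg_neg, Real.exp_log (hπpos _)]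
      have hint : Integrable π := by
        by_contra h
        simp [integral_undef h] at hπprob
      exact hint.lintegral_lt_top.ne
    · have := (abs_le.1 (sum_sub_sum_le_of_lipschitz hlip u v)).1
      nlinarith
  obtain ⟨c, hdens, hprob⟩ := gibbsDens_eq_exp hπpos (fun w => rfl) (hπm.add (hℓm.const_mul ρ)) hfin
  refine ⟨c, _, fun w => rfl, (hπm.add (hℓm.const_mul ρ)).add_const c, ?_, hdens, hprob⟩
  rw [strongConvexOn_iff_convex] at hπsc ⊢
  refine ((hπsc.add ((ConvexOn.univ_finset_sum Finset.univ hconv).smul hρ.le)).add_const c).congr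
    fun w _ => ?_
  simp only [Pi.add_apply, smul_eq_mul]
  ring

theorem gibbs_posterior_rdp
    (m ρ L : ℝ) (hm : 0 < m) (hρ : 0 < ρ) (hL : 0 ≤ L)
    (π : EuclideanSpace ℝ (Fin d) → ℝ) (hπpos : ∀ w, 0 < π w)
    (hπprob : ∫ w, π w = 1)
    (hπdiff : Differentiable ℝ (fun w => -Real.log (π w)))
    (hπdiff2 : Differentiable ℝ (fderiv ℝ (fun w => -Real.log (π w))))
    (hπsc : ConvexOn ℝ Set.univ (fun w => -Real.log (π w) - m / 2 * ‖w‖ ^ 2))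
    (ℓ ℓ' : Fin n → EuclideanSpace ℝ (Fin d) → ℝ)
    (hconv : ∀ i, ConvexOn ℝ Set.univ (ℓ i)) (hconv' : ∀ i, ConvexOn ℝ Set.univ (ℓ' i))
    (hlip : ∀ i u v, |ℓ i u - ℓ i v| ≤ L * ‖u - v‖)
    (hlip' : ∀ i u v, |ℓ' i u - ℓ' i v| ≤ L * ‖u - v‖)
    (hneighbor : ∃ j, ∀ i, i ≠ j → ℓ i = ℓ' i) :
    (∀ l : ℝ, 1 < l →
      renyiDiv volume (gibbsDens π ρ ℓ) (gibbsDens π ρ ℓ') l ≤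
        ((2 * ρ ^ 2 * L ^ 2 / m * l : ℝ) : EReal)) ∧
    klDiv' (volume.withDensity (gibbsDens π ρ ℓ))
        (volume.withDensity (gibbsDens π ρ ℓ')) ≤
      ((2 * ρ ^ 2 * L ^ 2 / m : ℝ) : EReal) := by
  have hπm : Measurable fun w => -Real.log (π w) := hπdiff.continuous.measurable
  have hπsc' : StrongConvexOn Set.univ m fun w => -Real.log (π w) :=
    strongConvexOn_iff_convex.2 hπsc
  obtain ⟨c, U, hU, hUm, -, hdens, hprob⟩ :=
    exists_gibbsDens_eq_exp hm hρ hπpos hπprob hπm hπsc' hconv hlip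
  obtain ⟨c', V, hV, hVm, hVsc, hdens', hprob'⟩ :=
    exists_gibbsDens_eq_exp hm hρ hπpos hπprob hπm hπsc' hconv' hlip'
  obtain ⟨j, hj⟩ := hneighbor
  have hUV : ∀ w, V w - U w = ρ * (ℓ' j w - ℓ j w) + (c' - c) := fun w => by
    have : ∑ i, ℓ' i w - ∑ i, ℓ i w = ℓ' j w - ℓ j w := by
      rw [← Finset.sum_sub_distrib]
      exact Finset.sum_eq_single j (fun i _ hi => by rw [hj i hi, sub_self]) (by simp)
    rw [hU, hV, ← this]
    ring
  have hhlip : ∀ u v, (V u - U u) - (V v - U v) ≤ 2 * ρ * L * ‖u - v‖ := fun u v => by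
    rw [hUV, hUV]
    have h1 := (abs_le.1 (hlip j u v)).1
    have h2 := (abs_le.1 (hlip' j u v)).2
    nlinarith
  have hexp : ∀ w, -U w = (V w - U w) - V w := fun w => by ring
  simp only [hexp] at hdens hprob
  have hmom := fun l (hl : (1 : ℝ) < l) =>
    hVsc.lintegral_exp_mul_sub_le hm hVm hprob' (hVm.sub hUm) hprob hhlip hl
  have hconst : (2 * ρ * L) ^ 2 / (2 * m) = 2 * ρ ^ 2 * L ^ 2 / m := by
    field_simp
  rw [hconst] at hmom
  rw [hdens, hdens']
  exact ⟨fun l hl => renyiDiv_exp_le hl (hmom l hl),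
    klDiv'_exp_le hVm (hVm.sub hUm) hprob' hprob hmom⟩
end
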